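/- arXiv:2007.08447 — 12 statements merged into one kernel-verified Lean document; each statement's English description precedes it below -/
import Mathlib

section
/- Let x ∈ 𝒳 be a leader strategy and let ω be a permutation of N such that the destruction ratios are nonincreasing along ω, i.e., p_{ω(i)} x_{ω(i)} / a_{ω(i)} ≥ p_{ω(j)} x_{ω(j)} / a_{ω(j)} whenever i < j. Let k = min{ j ∈ {1,...,n} : Σ_{i=1}^{j} a_{ω(i)} ≥ R_f } (which exists since R_f < Σ_{i∈N} a_i), and define y^ω ∈ ℝ^n by y^ω_{ω(i)} = a_{ω(i)} for i < k, y^ω_{ω(k)} = R_f − Σ_{i=1}^{k−1} a_{ω(i)}, and y^ω_{ω(i)} = 0 for i > k. Then y^ω ∈ 𝒴 and P(x, y^ω) ≤ P(x, y) for all y ∈ 𝒴; that is, y^ω is an optimal strategy for the follower. -/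
open Finset

/-- The leader's strategy set 𝒳. -/
def leaderSet (n : ℕ) (Rl : ℝ) : Set (Fin n → ℝ) :=
  {x | (∀ i, 0 ≤ x i) ∧ ∑ i, x i ≤ Rl}

/-- The follower's strategy set 𝒴. -/
def followerSet (n : ℕ) (a : Fin n → ℝ) (Rf : ℝ) : Set (Fin n → ℝ) :=
  {y | (∀ i, 0 ≤ y i ∧ y i ≤ a i) ∧ ∑ i, y i ≤ Rf}

/-- Total production after destruction P(x,y). -/
noncomputable def totProd (n : ℕ) (p a : Fin n → ℝ) (x y : Fin n → ℝ) : ℝ :=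
  ∑ i, p i * x i * (1 - y i / a i)

/-- Worst case total production after destruction P(x) = min over 𝒴. -/
noncomputable def worstProd (n : ℕ) (p a : Fin n → ℝ) (Rf : ℝ) (x : Fin n → ℝ) : ℝ :=
  sInf (totProd n p a x '' followerSet n a Rf)

/-- The composed net production rate p̄(S). -/
noncomputable def pbar (n : ℕ) (p a : Fin n → ℝ) (Rf : ℝ) (S : Finset (Fin n)) : ℝ :=
  if S = ∅ then 0
  else max ((∑ i ∈ S, a i - Rf) / (∑ i ∈ S, a i / p i)) 0

/-- A balanced strategy with support S. -/
def BalancedStrategy (n : ℕ) (p a : Fin n → ℝ) (Rl : ℝ)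
    (x : Fin n → ℝ) (S : Finset (Fin n)) : Prop :=
  ∑ i, x i = Rl ∧ (∀ i ∈ S, 0 < x i) ∧
  (∀ i ∈ S, ∀ j ∈ S, p i * x i / a i = p j * x j / a j) ∧
  ∀ i, i ∉ S → x i = 0

/-- A semi-balanced strategy with support S and extra facility r. -/
def SemiBalancedStrategy (n : ℕ) (p a : Fin n → ℝ) (Rl : ℝ)
    (x : Fin n → ℝ) (S : Finset (Fin n)) (r : Fin n) : Prop :=
  r ∉ S ∧ ∑ i, x i = Rl ∧ (∀ i ∈ insert r S, 0 < x i) ∧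
  (∀ i ∈ S, ∀ j ∈ S, p i * x i / a i = p j * x j / a j) ∧
  (∀ i ∈ S, p r * x r / a r < p i * x i / a i) ∧
  ∀ i, i ∉ insert r S → x i = 0

theorem followerGreedyOptimal {n : ℕ} (hn : 0 < n) (p a : Fin n → ℝ)
    (hp : ∀ i, 0 < p i) (hpmono : ∀ i j : Fin n, i ≤ j → p j ≤ p i)
    (ha : ∀ i, 0 < a i) (Rl Rf : ℝ) (hRl : 0 < Rl) (hRf : 0 < Rf)
    (hRfa : Rf < ∑ i, a i)
    (x : Fin n → ℝ) (hx : x ∈ leaderSet n Rl)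
    (ω : Equiv.Perm (Fin n))
    (hω : ∀ i j : Fin n, i ≤ j →
      p (ω j) * x (ω j) / a (ω j) ≤ p (ω i) * x (ω i) / a (ω i))
    (k : Fin n)
    (hk1 : Rf ≤ ∑ i ∈ Finset.filter (fun i => i ≤ k) Finset.univ, a (ω i))
    (hk2 : ∀ j : Fin n,
      Rf ≤ ∑ i ∈ Finset.filter (fun i => i ≤ j) Finset.univ, a (ω i) → k ≤ j)
    (y : Fin n → ℝ)
    (hy1 : ∀ i : Fin n, i < k → y (ω i) = a (ω i))
    (hy2 : y (ω k) = Rf - ∑ i ∈ Finset.filter (fun i => i < k) Finset.univ, a (ω i))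
    (hy3 : ∀ i : Fin n, k < i → y (ω i) = 0) :
    y ∈ followerSet n a Rf ∧
      ∀ y' ∈ followerSet n a Rf, totProd n p a x y ≤ totProd n p a x y' := by
  have hfull : ∀ f : Fin n → ℝ, ∑ i ∈ univ.filter (fun i => i ≤ k), f i
      = f k + ∑ i ∈ univ.filter (fun i => i < k), f i := by
    intro f
    have h : univ.filter (fun i => i ≤ k) = insert k (univ.filter (fun i => i < k)) := by
      ext i
      simp [le_iff_eq_or_lt]
    rw [h, sum_insert (by simp)]
  have hlt : ∑ i ∈ univ.filter (fun i => i < k), a (ω i) ≤ Rf := by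
    by_contra! h
    by_cases h0 : k.val = 0
    · have he : univ.filter (fun i => i < k) = ∅ := by
        ext i
        simp [Fin.lt_def, h0]
      rw [he, sum_empty] at h
      linarith
    · let j : Fin n := ⟨k.val - 1, by omega⟩
      have he : univ.filter (fun i => i < k) = univ.filter (fun i => i ≤ j) := by
        ext i
        simp only [mem_filter, mem_univ, true_and, Fin.lt_def, Fin.le_def, j]
        omega
      rw [he] at h
      have := Fin.le_def.1 (hk2 j h.le)
      simp only [j] at this
      omega
  have hsum : ∑ i, y i = Rf := by
    rw [← Equiv.sum_comp ω y,
      ← sum_subset (filter_subset (fun i => i ≤ k) univ)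
        (fun i _ hi => hy3 i (by simpa using hi)),
      hfull, hy2,
      sum_congr rfl (fun i hi => hy1 i (mem_filter.1 hi).2)]
    ring
  refine ⟨⟨fun i => ?_, hsum.le⟩, fun y' hy' => ?_⟩
  · obtain ⟨i, rfl⟩ := ω.surjective i
    rcases lt_trichotomy i k with h | rfl | h
    · rw [hy1 i h]
      exact ⟨(ha _).le, le_rfl⟩
    · rw [hfull] at hk1
      rw [hy2]
      constructor <;> linarith
    · rw [hy3 i h]
      exact ⟨le_rfl, (ha _).le⟩
  · obtain ⟨hbox, hbudget⟩ := hy'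
    set c := p (ω k) * x (ω k) / a (ω k)
    have hc0 : 0 ≤ c := div_nonneg (mul_nonneg (hp _).le (hx.1 _)) (ha _).le
    have hterm : ∀ i, c * (y i - y' i) ≤
        p i * x i * (1 - y' i / a i) - p i * x i * (1 - y i / a i) := by
      intro i
      obtain ⟨i, rfl⟩ := ω.surjective i
      have hrw : p (ω i) * x (ω i) * (1 - y' (ω i) / a (ω i))
          - p (ω i) * x (ω i) * (1 - y (ω i) / a (ω i))
          = p (ω i) * x (ω i) / a (ω i) * (y (ω i) - y' (ω i)) := by ring
      rw [hrw]
      rcases lt_trichotomy i k with h | rfl | h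
      · rw [hy1 i h]
        exact mul_le_mul_of_nonneg_right (hω i k h.le) (sub_nonneg.2 (hbox _).2)
      · exact le_rfl
      · rw [hy3 i h]
        exact mul_le_mul_of_nonpos_right (hω k i h.le) (by linarith [(hbox (ω i)).1])
    have hle := sum_le_sum (fun i (_ : i ∈ univ) => hterm i)
    rw [← mul_sum, sum_sub_distrib, sum_sub_distrib, hsum] at hle
    have := mul_nonneg hc0 (sub_nonneg.2 hbudget)
    unfold totProd
    linarith
end

section
/- There exists a strategy x ∈ 𝒳 that is optimal for the leader (i.e., P(x) ≥ P(x') for all x' ∈ 𝒳) and is either balanced or semi-balanced. -/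
open Finset

/-- The greedy order for a fractional knapsack with weights `w`, sizes `c` and capacity `R`: the
items of `S` are packed completely, `k` is the last packed item, and all others are left out. -/
lemma exists_greedy_split {ι : Type*} [DecidableEq ι] (w c : ι → ℝ) (R : ℝ) (hR : 0 < R)
    (T : Finset ι) (hT : R ≤ ∑ i ∈ T, c i) :
    ∃ S ⊆ T, ∃ k ∈ T, k ∉ S ∧ ∑ i ∈ S, c i < R ∧ R ≤ ∑ i ∈ S, c i + c k ∧
      (∀ i ∈ S, w k ≤ w i) ∧ ∀ i ∈ T, i ∉ S → w i ≤ w k := by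
  induction T using Finset.induction_on_min_value w with
  | empty => exact absurd hT (by simpa using hR)
  | insert k T hk hmin ih =>
    rcases lt_or_ge (∑ i ∈ T, c i) R with h | h
    · refine ⟨T, subset_insert _ _, k, mem_insert_self _ _, hk, h, ?_, hmin, ?_⟩
      · rw [sum_insert hk] at hT; linarith
      · intro i hi hiT
        rcases mem_insert.1 hi with rfl | hi
        · exact le_rfl
        · exact absurd hi hiT
    · obtain ⟨S, hS, j, hj, hjS, h1, h2, h3, h4⟩ := ih h
      refine ⟨S, hS.trans (subset_insert _ _), j, mem_insert_of_mem hj, hjS, h1, h2, h3, ?_⟩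
      intro i hi hiS
      rcases mem_insert.1 hi with rfl | hi
      · exact hmin j hj
      · exact h4 i hi hiS

/-- The packing that fills the items of `S` completely and puts the remaining capacity on `k`. -/
noncomputable def greedyFill {ι : Type*} [DecidableEq ι] (c : ι → ℝ) (R : ℝ) (S : Finset ι)
    (k i : ι) : ℝ :=
  if i ∈ S then c i else if i = k then R - ∑ j ∈ S, c j else 0

lemma sum_greedyFill {ι : Type*} [DecidableEq ι] [Fintype ι] (c : ι → ℝ) (R : ℝ) {S : Finset ι}
    {k : ι} (hk : k ∉ S) : ∑ i, greedyFill c R S k i = R := by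
  have h : ∑ i, greedyFill c R S k i = ∑ i ∈ insert k S, greedyFill c R S k i := by
    refine (sum_subset (subset_univ _) fun i _ hi => ?_).symm
    rw [mem_insert, not_or] at hi
    simp [greedyFill, hi.1, hi.2]
  have hS : ∑ i ∈ S, greedyFill c R S k i = ∑ i ∈ S, c i :=
    sum_congr rfl fun i hi => by simp [greedyFill, hi]
  rw [h, sum_insert hk, hS]
  simp [greedyFill, hk]

lemma greedyFill_mem_Icc {ι : Type*} [DecidableEq ι] {c : ι → ℝ} {R : ℝ} {S : Finset ι} {k : ι}
    (hc : ∀ i, 0 ≤ c i) (h1 : ∑ i ∈ S, c i < R) (h2 : R ≤ ∑ i ∈ S, c i + c k) (i : ι) :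
    0 ≤ greedyFill c R S k i ∧ greedyFill c R S k i ≤ c i := by
  unfold greedyFill
  split_ifs with hS hk
  · exact ⟨hc i, le_rfl⟩
  · subst hk; constructor <;> linarith
  · exact ⟨le_rfl, hc i⟩

lemma isCompact_leaderSet (n : ℕ) (Rl : ℝ) : IsCompact (leaderSet n Rl) := by
  refine (isCompact_Icc (a := fun _ : Fin n => (0 : ℝ)) (b := fun _ => Rl)).of_isClosed_subset
    ?_ ?_
  · have h : leaderSet n Rl = (⋂ i, {x | 0 ≤ x i}) ∩ {x | ∑ i, x i ≤ Rl} := by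
      ext; simp [leaderSet]
    rw [h]
    exact (isClosed_iInter fun i => isClosed_le (by fun_prop) (by fun_prop)).inter
      (isClosed_le (by fun_prop) (by fun_prop))
  · rintro x ⟨h0, hs⟩
    exact ⟨h0, fun i => (single_le_sum (fun j _ => h0 j) (mem_univ i)).trans hs⟩

lemma isCompact_followerSet (n : ℕ) (a : Fin n → ℝ) (Rf : ℝ) :
    IsCompact (followerSet n a Rf) := by
  have h : followerSet n a Rf = Set.Icc 0 a ∩ {y | ∑ i, y i ≤ Rf} := by
    ext y; simp [followerSet, Pi.le_def, forall_and]
  rw [h]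
  exact isCompact_Icc.inter_right (isClosed_le (by fun_prop) (by fun_prop))

lemma continuous_worstProd (n : ℕ) (p a : Fin n → ℝ) (Rf : ℝ) :
    Continuous (worstProd n p a Rf) := by
  refine (isCompact_followerSet n a Rf).continuous_sInf (f := totProd n p a) ?_
  unfold totProd Function.HasUncurry.uncurry
  simp only [Function.hasUncurryInduction, div_eq_mul_inv]
  fun_prop

/-- Dual objective of the follower's problem at threshold `t`. -/
noncomputable def thresholdProd (n : ℕ) (p a : Fin n → ℝ) (Rf : ℝ) (x : Fin n → ℝ) (t : ℝ) : ℝ :=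
  ∑ i, min (p i * x i) (a i * t) - t * Rf

section

variable {n : ℕ} {p a : Fin n → ℝ} {Rl Rf : ℝ}

lemma thresholdProd_le_totProd (ha : ∀ i, 0 < a i) {x y : Fin n → ℝ} {t : ℝ} (ht : 0 ≤ t)
    (hy : y ∈ followerSet n a Rf) : thresholdProd n p a Rf x t ≤ totProd n p a x y := by
  obtain ⟨hy, hs⟩ := hy
  have h : ∑ i, (min (p i * x i) (a i * t) - t * y i) ≤ totProd n p a x y := by
    refine sum_le_sum fun i _ => ?_
    have hq0 : 0 ≤ y i / a i := div_nonneg (hy i).1 (ha i).le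
    have hq1 : y i / a i ≤ 1 := (div_le_one (ha i)).2 (hy i).2
    have hya : t * y i = a i * t * (y i / a i) := by field_simp [(ha i).ne']
    have h1 := mul_le_mul_of_nonneg_right (min_le_left (p i * x i) (a i * t))
      (sub_nonneg.2 hq1)
    have h2 := mul_le_mul_of_nonneg_right (min_le_right (p i * x i) (a i * t)) hq0
    rw [hya]; linarith
  rw [sum_sub_distrib, ← mul_sum] at h
  have := mul_le_mul_of_nonneg_left hs ht
  unfold thresholdProd
  linarith

lemma thresholdProd_le_worstProd (ha : ∀ i, 0 < a i) (hRf : 0 < Rf) (x : Fin n → ℝ) {t : ℝ}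
    (ht : 0 ≤ t) : thresholdProd n p a Rf x t ≤ worstProd n p a Rf x := by
  refine le_csInf ⟨_, 0, ⟨fun i => ⟨le_rfl, (ha i).le⟩, by simpa using hRf.le⟩, rfl⟩ ?_
  rintro _ ⟨y, hy, rfl⟩
  exact thresholdProd_le_totProd ha ht hy

lemma exists_worstProd_le_thresholdProd (hp : ∀ i, 0 < p i) (ha : ∀ i, 0 < a i) (hRf : 0 < Rf)
    (hRfa : Rf < ∑ i, a i) {x : Fin n → ℝ} (hx : ∀ i, 0 ≤ x i) :
    ∃ t, 0 ≤ t ∧ worstProd n p a Rf x ≤ thresholdProd n p a Rf x t := by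
  obtain ⟨S, -, k, -, hkS, h1, h2, hge, hle⟩ :=
    exists_greedy_split (fun i => p i * x i / a i) a Rf hRf univ hRfa.le
  have ht : 0 ≤ p k * x k / a k := div_nonneg (mul_nonneg (hp k).le (hx k)) (ha k).le
  refine ⟨p k * x k / a k, ht, ?_⟩
  set t := p k * x k / a k with htk
  have hsum := sum_greedyFill a Rf hkS
  have hmem : greedyFill a Rf S k ∈ followerSet n a Rf :=
    ⟨greedyFill_mem_Icc (fun i => (ha i).le) h1 h2, hsum.le⟩
  have hbdd : BddBelow (totProd n p a x '' followerSet n a Rf) := by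
    refine ⟨thresholdProd n p a Rf x t, ?_⟩
    rintro _ ⟨y, hy, rfl⟩
    exact thresholdProd_le_totProd ha ht hy
  refine (csInf_le hbdd ⟨_, hmem, rfl⟩).trans_eq ?_
  unfold thresholdProd
  nth_rewrite 2 [← hsum]
  rw [mul_sum, ← sum_sub_distrib]
  refine sum_congr rfl fun i _ => ?_
  have hai := (ha i).ne'
  by_cases hiS : i ∈ S
  · have := (le_div_iff₀ (ha i)).1 (hge i hiS)
    rw [min_eq_right (by linarith)]
    simp only [greedyFill, if_pos hiS, div_self hai]
    ring
  · have := (div_le_iff₀ (ha i)).1 (hle i (mem_univ i) hiS)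
    rw [min_eq_left (by linarith)]
    by_cases hik : i = k
    · subst hik
      rw [htk]
      field_simp
    · simp [greedyFill, hiS, hik]

/-- For every threshold, the strategy filling up the facilities greedily in order of production
rate is at least as good as any other one. -/
lemma exists_balanced_or_semiBalanced_thresholdProd_le (hn : 0 < n) (hp : ∀ i, 0 < p i)
    (ha : ∀ i, 0 < a i) (hRl : 0 < Rl) (hRfa : Rf < ∑ i, a i) {x : Fin n → ℝ}
    (hx : x ∈ leaderSet n Rl) {t : ℝ} (ht : 0 ≤ t) :
    ∃ x' ∈ leaderSet n Rl, ∃ t', 0 ≤ t' ∧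
      thresholdProd n p a Rf x t ≤ thresholdProd n p a Rf x' t' ∧
      ((∃ S : Finset (Fin n), BalancedStrategy n p a Rl x' S) ∨
       (∃ (S : Finset (Fin n)) (r : Fin n), SemiBalancedStrategy n p a Rl x' S r)) := by
  have : Nonempty (Fin n) := ⟨⟨0, hn⟩⟩
  have hA : 0 < ∑ i, a i / p i := sum_pos (fun i _ => div_pos (ha i) (hp i)) univ_nonempty
  rcases lt_or_ge (t * ∑ i, a i / p i) Rl with hlt | hge
  · set s := Rl / ∑ i, a i / p i with hs
    have hs0 : 0 < s := div_pos hRl hA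
    have hts : t ≤ s := ((lt_div_iff₀ hA).2 hlt).le
    have hpx : ∀ i, p i * (s * (a i / p i)) = a i * s := fun i => by
      have := (hp i).ne'
      field_simp
    have hsum : ∑ i, s * (a i / p i) = Rl := by
      rw [← mul_sum, hs, div_mul_cancel₀ _ hA.ne']
    have hpos : ∀ i, 0 < s * (a i / p i) := fun i => mul_pos hs0 (div_pos (ha i) (hp i))
    refine ⟨fun i => s * (a i / p i), ⟨fun i => (hpos i).le, hsum.le⟩, s, hs0.le, ?_,
      Or.inl ⟨univ, hsum, fun i _ => hpos i, fun i _ j _ => ?_, fun i hi => ?_⟩⟩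
    · have h1 : ∑ i, min (p i * x i) (a i * t) ≤ ∑ i, a i * t :=
        sum_le_sum fun i _ => min_le_right _ _
      rw [← sum_mul] at h1
      simp only [thresholdProd, hpx, min_self, ← sum_mul]
      nlinarith
    · simp only [hpx]
      rw [mul_div_cancel_left₀ _ (ha i).ne', mul_div_cancel_left₀ _ (ha j).ne']
    · exact absurd (mem_univ i) hi
  · have ht0 : 0 < t := by
      rcases ht.lt_or_eq with h | h
      · exact h
      · subst h; linarith
    set c : Fin n → ℝ := fun i => t * (a i / p i) with hc
    have hc0 : ∀ i, 0 < c i := fun i => mul_pos ht0 (div_pos (ha i) (hp i))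
    have hpc : ∀ i, p i * c i = a i * t := fun i => by
      have := (hp i).ne'
      simp only [hc]
      field_simp
    have hzc : ∀ i, p i * c i / a i = t := fun i => by
      rw [hpc, mul_div_cancel_left₀ _ (ha i).ne']
    rw [mul_sum] at hge
    obtain ⟨S, -, k, -, hkS, h1, h2, hpge, hple⟩ := exists_greedy_split p c Rl hRl univ hge
    have hsum := sum_greedyFill c Rl hkS
    have hIcc := greedyFill_mem_Icc (fun i => (hc0 i).le) h1 h2
    have hS : ∀ i ∈ S, greedyFill c Rl S k i = c i := fun i hi => by simp [greedyFill, hi]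
    have hk : greedyFill c Rl S k k = Rl - ∑ j ∈ S, c j := by simp [greedyFill, hkS]
    have hout : ∀ i ∉ insert k S, greedyFill c Rl S k i = 0 := fun i hi => by
      rw [mem_insert, not_or] at hi
      simp [greedyFill, hi.1, hi.2]
    refine ⟨greedyFill c Rl S k, ⟨fun i => (hIcc i).1, hsum.le⟩, t, ht, ?_, ?_⟩
    · have hterm : ∀ i ∈ univ, min (p i * x i) (a i * t) -
          min (p i * greedyFill c Rl S k i) (a i * t) ≤
          p k * (x i - greedyFill c Rl S k i) := by
        intro i _
        have hfill : p i * greedyFill c Rl S k i ≤ a i * t :=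
          (mul_le_mul_of_nonneg_left (hIcc i).2 (hp i).le).trans_eq (hpc i)
        rw [min_eq_left hfill]
        have hl := min_le_left (p i * x i) (a i * t)
        have hr := min_le_right (p i * x i) (a i * t)
        by_cases hiS : i ∈ S
        · rw [hS i hiS, hpc]
          rcases le_total (c i) (x i) with h | h
          · have := mul_nonneg (hp k).le (sub_nonneg.2 h)
            linarith
          · have := mul_le_mul_of_nonneg_right (hpge i hiS) (sub_nonneg.2 h)
            linarith [hpc i]
        · by_cases hik : i = k
          · subst hik; linarith
          · rw [hout i (by simp [hik, hiS])]
            have := mul_le_mul_of_nonneg_right (hple i (mem_univ i) hiS) (hx.1 i)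
            linarith
      have h := sum_le_sum hterm
      rw [sum_sub_distrib, ← mul_sum, sum_sub_distrib, hsum] at h
      have := mul_nonneg (hp k).le (sub_nonneg.2 hx.2)
      unfold thresholdProd
      linarith
    · have hpos : ∀ i ∈ insert k S, 0 < greedyFill c Rl S k i := by
        intro i hi
        rcases mem_insert.1 hi with rfl | hi
        · rw [hk]; linarith
        · rw [hS i hi]; exact hc0 i
      rcases h2.lt_or_eq with h | h
      · refine Or.inr ⟨S, k, hkS, hsum, hpos, fun i hi j hj => ?_, fun i hi => ?_, hout⟩
        · rw [hS i hi, hS j hj, hzc, hzc]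
        · rw [hS i hi, hzc, ← hzc k, hk]
          exact div_lt_div_of_pos_right (mul_lt_mul_of_pos_left (by linarith) (hp k)) (ha k)
      · have hfull : ∀ i ∈ insert k S, greedyFill c Rl S k i = c i := by
          intro i hi
          rcases mem_insert.1 hi with rfl | hi
          · rw [hk]; linarith
          · exact hS i hi
        refine Or.inl ⟨insert k S, hsum, hpos, fun i hi j hj => ?_, hout⟩
        rw [hfull i hi, hfull j hj, hzc, hzc]

end

theorem existsOptimalBalancedOrSemiBalanced {n : ℕ} (hn : 0 < n) (p a : Fin n → ℝ)
    (hp : ∀ i, 0 < p i) (hpmono : ∀ i j : Fin n, i ≤ j → p j ≤ p i)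
    (ha : ∀ i, 0 < a i) (Rl Rf : ℝ) (hRl : 0 < Rl) (hRf : 0 < Rf)
    (hRfa : Rf < ∑ i, a i) :
    ∃ x ∈ leaderSet n Rl,
      (∀ x' ∈ leaderSet n Rl, worstProd n p a Rf x' ≤ worstProd n p a Rf x) ∧
      ((∃ S : Finset (Fin n), BalancedStrategy n p a Rl x S) ∨
       (∃ (S : Finset (Fin n)) (r : Fin n), SemiBalancedStrategy n p a Rl x S r)) := by
  obtain ⟨x, hx, hmax⟩ := (isCompact_leaderSet n Rl).exists_isMaxOn
    ⟨0, fun _ => le_rfl, by simpa using hRl.le⟩ (continuous_worstProd n p a Rf).continuousOn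
  obtain ⟨t, ht, hxt⟩ := exists_worstProd_le_thresholdProd hp ha hRf hRfa hx.1
  obtain ⟨x', hx', t', ht', hle, hbal⟩ :=
    exists_balanced_or_semiBalanced_thresholdProd_le hn hp ha hRl hRfa hx ht
  refine ⟨x', hx', fun z hz => ?_, hbal⟩
  calc worstProd n p a Rf z ≤ worstProd n p a Rf x := hmax hz
    _ ≤ thresholdProd n p a Rf x t := hxt
    _ ≤ thresholdProd n p a Rf x' t' := hle
    _ ≤ worstProd n p a Rf x' := thresholdProd_le_worstProd ha hRf x' ht'
end

section
/- Let x ∈ 𝒳 be a balanced strategy with support S. Then the worst case total production after destruction satisfies P(x) = (Σ_{i∈S} a_i − R_f)·R_l / (Σ_{i∈S} a_i/p_i) if R_f ≤ Σ_{i∈S} a_i, and P(x) = 0 if R_f > Σ_{i∈S} a_i. Moreover, x_i = a_i R_l / (p_i · Σ_{j∈S} a_j/p_j) for all i ∈ S, and x_i = 0 for all i ∈ N∖S. -/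
open Finset

section Balanced

variable {n : ℕ} {p a x : Fin n → ℝ} {Rl Rf : ℝ} {S : Finset (Fin n)}

theorem BalancedStrategy.nonempty (hRl : 0 < Rl) (h : BalancedStrategy n p a Rl x S) :
    S.Nonempty := by
  obtain ⟨hsum, -, -, hzero⟩ := h
  rw [Finset.nonempty_iff_ne_empty]
  rintro rfl
  simp only [hzero _ (Finset.notMem_empty _), Finset.sum_const_zero] at hsum
  exact hRl.ne hsum

theorem BalancedStrategy.sum_div_pos (hp : ∀ i, 0 < p i) (ha : ∀ i, 0 < a i) (hRl : 0 < Rl)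
    (h : BalancedStrategy n p a Rl x S) : 0 < ∑ j ∈ S, a j / p j :=
  Finset.sum_pos (fun j _ => div_pos (ha j) (hp j)) (h.nonempty hRl)

/-- The common level `p i * x i / a i` of a balanced strategy is `Rl / ∑ j ∈ S, a j / p j`. -/
theorem BalancedStrategy.mul_eq (hp : ∀ i, 0 < p i) (ha : ∀ i, 0 < a i) (hRl : 0 < Rl)
    (h : BalancedStrategy n p a Rl x S) {i : Fin n} (hi : i ∈ S) :
    p i * x i = Rl / (∑ j ∈ S, a j / p j) * a i := by
  have hB := h.sum_div_pos hp ha hRl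
  obtain ⟨hsum, -, hlevel, hzero⟩ := h
  rw [← div_eq_iff (ha i).ne', eq_div_iff hB.ne', Finset.mul_sum, ← hsum,
    ← Finset.sum_subset (Finset.subset_univ S) fun j _ hj => hzero j hj]
  refine Finset.sum_congr rfl fun j hj => ?_
  rw [hlevel i hi j hj]
  field_simp [(hp j).ne', (ha j).ne']

theorem BalancedStrategy.totProd_eq (hp : ∀ i, 0 < p i) (ha : ∀ i, 0 < a i) (hRl : 0 < Rl)
    (h : BalancedStrategy n p a Rl x S) (y : Fin n → ℝ) :
    totProd n p a x y =
      Rl / (∑ j ∈ S, a j / p j) * (∑ i ∈ S, a i - ∑ i ∈ S, y i) := by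
  rw [totProd, ← Finset.sum_subset (Finset.subset_univ S) fun j _ hj => by
    rw [h.2.2.2 j hj]; ring, ← Finset.sum_sub_distrib, Finset.mul_sum]
  refine Finset.sum_congr rfl fun i hi => ?_
  rw [h.mul_eq hp ha hRl hi, mul_assoc, mul_sub, mul_one, mul_div_cancel₀ _ (ha i).ne']

theorem BalancedStrategy.worstProd_eq (hp : ∀ i, 0 < p i) (ha : ∀ i, 0 < a i) (hRl : 0 < Rl)
    (hRf : 0 < Rf) (h : BalancedStrategy n p a Rl x S) :
    worstProd n p a Rf x =
      Rl / (∑ j ∈ S, a j / p j) * (∑ i ∈ S, a i - min (∑ i ∈ S, a i) Rf) := by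
  have hB := h.sum_div_pos hp ha hRl
  have hA : 0 < ∑ i ∈ S, a i := Finset.sum_pos (fun j _ => ha j) (h.nonempty hRl)
  refine IsLeast.csInf_eq ⟨?_, ?_⟩
  · set t := min (∑ i ∈ S, a i) Rf / ∑ i ∈ S, a i with ht
    have ht0 : 0 ≤ t := by positivity
    have ht1 : t ≤ 1 := (div_le_one hA).2 (min_le_left _ _)
    have htA : t * ∑ i ∈ S, a i = min (∑ i ∈ S, a i) Rf := div_mul_cancel₀ _ hA.ne'
    refine ⟨fun i => if i ∈ S then t * a i else 0, ⟨fun i => ?_, ?_⟩, ?_⟩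
    · have hi := ha i
      dsimp only
      split_ifs
      · exact ⟨by positivity, mul_le_of_le_one_left hi.le ht1⟩
      · exact ⟨le_rfl, hi.le⟩
    · rw [Finset.sum_ite_mem, Finset.univ_inter, ← Finset.mul_sum, htA]
      exact min_le_right _ _
    · rw [h.totProd_eq hp ha hRl, Finset.sum_ite_mem, Finset.inter_self, ← Finset.mul_sum, htA]
  · rintro _ ⟨y, ⟨hy, hysum⟩, rfl⟩
    rw [h.totProd_eq hp ha hRl]
    refine mul_le_mul_of_nonneg_left (sub_le_sub_left (le_min ?_ ?_) _) (by positivity)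
    · exact Finset.sum_le_sum fun i _ => (hy i).2
    · exact (Finset.sum_le_univ_sum_of_nonneg fun i => (hy i).1).trans hysum

end Balanced

theorem balancedWorstProdFormula {n : ℕ} (hn : 0 < n) (p a : Fin n → ℝ)
    (hp : ∀ i, 0 < p i) (hpmono : ∀ i j : Fin n, i ≤ j → p j ≤ p i)
    (ha : ∀ i, 0 < a i) (Rl Rf : ℝ) (hRl : 0 < Rl) (hRf : 0 < Rf)
    (hRfa : Rf < ∑ i, a i)
    (x : Fin n → ℝ) (hx : x ∈ leaderSet n Rl)
    (S : Finset (Fin n)) (hbal : BalancedStrategy n p a Rl x S) :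
    (Rf ≤ ∑ i ∈ S, a i →
      worstProd n p a Rf x = (∑ i ∈ S, a i - Rf) * Rl / (∑ i ∈ S, a i / p i)) ∧
    (∑ i ∈ S, a i < Rf → worstProd n p a Rf x = 0) ∧
    (∀ i ∈ S, x i = a i * Rl / (p i * ∑ j ∈ S, a j / p j)) ∧
    (∀ i, i ∉ S → x i = 0) := by
  refine ⟨fun hle => ?_, fun hlt => ?_, fun i hi => ?_, hbal.2.2.2⟩
  · rw [hbal.worstProd_eq hp ha hRl hRf, min_eq_right hle]
    ring
  · rw [hbal.worstProd_eq hp ha hRl hRf, min_eq_left hlt.le, sub_self, mul_zero]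
  · have hB := hbal.sum_div_pos hp ha hRl
    rw [eq_div_iff (mul_pos (hp i) hB).ne', ← mul_assoc, mul_comm (x i),
      hbal.mul_eq hp ha hRl hi, mul_right_comm, div_mul_cancel₀ _ hB.ne', mul_comm]
end

section
/- Let x ∈ 𝒳 be a balanced strategy with support S. Then P(x) = p̄(S)·R_l. -/
open Finset

/-- On a balanced strategy the total production depends on the follower only through the
resources spent on the support. -/
theorem totProd_eq_of_balanced {n : ℕ} {p a x : Fin n → ℝ} {S : Finset (Fin n)} {c : ℝ}
    (ha : ∀ i, 0 < a i) (hc : ∀ i ∈ S, p i * x i = c * a i) (h0 : ∀ i, i ∉ S → x i = 0)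
    (y : Fin n → ℝ) :
    totProd n p a x y = c * (∑ i ∈ S, a i - ∑ i ∈ S, y i) := by
  rw [← Finset.sum_sub_distrib, Finset.mul_sum, totProd,
    ← Finset.sum_subset (Finset.subset_univ S) fun i _ hi => by simp [h0 i hi]]
  refine Finset.sum_congr rfl fun i hi => ?_
  have := (ha i).ne'
  rw [hc i hi]
  field_simp

/-- The follower's optimal attack on a balanced strategy spends as much as possible on the
support. -/
theorem isLeast_totProd_of_balanced {n : ℕ} {p a x : Fin n → ℝ} {S : Finset (Fin n)}
    {c Rf : ℝ} (ha : ∀ i, 0 < a i) (hRf : 0 ≤ Rf) (hS : S.Nonempty) (hc0 : 0 ≤ c)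
    (hc : ∀ i ∈ S, p i * x i = c * a i) (h0 : ∀ i, i ∉ S → x i = 0) :
    IsLeast (totProd n p a x '' followerSet n a Rf) (c * max (∑ i ∈ S, a i - Rf) 0) := by
  have hA : 0 < ∑ i ∈ S, a i := Finset.sum_pos (fun i _ => ha i) hS
  constructor
  · set A := ∑ i ∈ S, a i with hAdef
    set t := min 1 (Rf / A)
    have ht0 : 0 ≤ t := le_min zero_le_one (div_nonneg hRf hA.le)
    have htA : t * A = min A Rf := by
      rw [min_mul_of_nonneg _ _ hA.le, one_mul, div_mul_cancel₀ _ hA.ne']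
    have hsum : ∑ i ∈ S, (if i ∈ S then t * a i else 0) = min A Rf := by
      rw [← htA, hAdef, Finset.mul_sum]
      exact Finset.sum_congr rfl fun i hi => if_pos hi
    refine ⟨fun i => if i ∈ S then t * a i else 0, ⟨fun i => ?_, ?_⟩, ?_⟩
    · dsimp only
      split_ifs
      · exact ⟨mul_nonneg ht0 (ha i).le, mul_le_of_le_one_left (ha i).le (min_le_left _ _)⟩
      · exact ⟨le_rfl, (ha i).le⟩
    · rw [← Finset.sum_subset (Finset.subset_univ S) fun i _ hi => if_neg hi, hsum]
      exact min_le_right _ _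
    · rw [totProd_eq_of_balanced ha hc h0, hsum]
      congr 1
      rcases le_total A Rf with h | h
      · rw [min_eq_left h, max_eq_right (by linarith), sub_self]
      · rw [min_eq_right h, max_eq_left (by linarith)]
  · rintro _ ⟨y, ⟨hy, hyR⟩, rfl⟩
    rw [totProd_eq_of_balanced ha hc h0]
    refine mul_le_mul_of_nonneg_left (max_le ?_ ?_) hc0
    · have := Finset.sum_le_sum_of_subset_of_nonneg (Finset.subset_univ S)
        fun i _ _ => (hy i).1
      linarith
    · exact sub_nonneg.2 (Finset.sum_le_sum fun i _ => (hy i).2)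

theorem balancedWorstProdEqPbarMulRl {n : ℕ} (hn : 0 < n) (p a : Fin n → ℝ)
    (hp : ∀ i, 0 < p i) (hpmono : ∀ i j : Fin n, i ≤ j → p j ≤ p i)
    (ha : ∀ i, 0 < a i) (Rl Rf : ℝ) (hRl : 0 < Rl) (hRf : 0 < Rf)
    (hRfa : Rf < ∑ i, a i)
    (x : Fin n → ℝ) (hx : x ∈ leaderSet n Rl)
    (S : Finset (Fin n)) (hbal : BalancedStrategy n p a Rl x S) :
    worstProd n p a Rf x = pbar n p a Rf S * Rl := by
  obtain ⟨hsum, hpos, heq, h0⟩ := hbal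
  have hsumS : ∑ i ∈ S, x i = Rl := by
    rw [← hsum]
    exact Finset.sum_subset (Finset.subset_univ S) fun i _ hi => h0 i hi
  have hS : S.Nonempty := by
    rw [Finset.nonempty_iff_ne_empty]
    rintro rfl
    rw [Finset.sum_empty] at hsumS
    exact hRl.ne hsumS
  obtain ⟨k, hk⟩ := hS
  obtain ⟨c, hcdef⟩ : ∃ c, c = p k * x k / a k := ⟨_, rfl⟩
  have hc0 : 0 ≤ c := hcdef ▸ (div_pos (mul_pos (hp k) (hpos k hk)) (ha k)).le
  have hc : ∀ i ∈ S, p i * x i = c * a i := fun i hi => by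
    rw [hcdef, heq k hk i hi, div_mul_cancel₀ _ (ha i).ne']
  have hT : 0 < ∑ i ∈ S, a i / p i :=
    Finset.sum_pos (fun i _ => div_pos (ha i) (hp i)) ⟨k, hk⟩
  have hR : Rl = c * ∑ i ∈ S, a i / p i := by
    rw [← hsumS, Finset.mul_sum]
    refine Finset.sum_congr rfl fun i hi => ?_
    rw [← mul_div_assoc, ← hc i hi, mul_div_cancel_left₀ _ (hp i).ne']
  rw [worstProd, (isLeast_totProd_of_balanced ha hRf.le ⟨k, hk⟩ hc0 hc h0).csInf_eq,
    pbar, if_neg (Finset.ne_empty_of_mem hk), hR, mul_left_comm,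
    max_mul_of_nonneg _ _ hT.le, div_mul_cancel₀ _ hT.ne', zero_mul]
end

section
/- Let x ∈ 𝒳 be a semi-balanced strategy with support S and extra facility r. Then P(x) = p̄(S)·(R_l − x_r) + p_r x_r if R_f ≤ Σ_{i∈S} a_i; P(x) = (p_r x_r / a_r)·(Σ_{i∈S∪{r}} a_i − R_f) if Σ_{i∈S} a_i < R_f < Σ_{i∈S∪{r}} a_i; and P(x) = 0 if R_f ≥ Σ_{i∈S∪{r}} a_i. Moreover, x_i = a_i (R_l − x_r) / (p_i · Σ_{j∈S} a_j/p_j) for all i ∈ S, and x_i = 0 for all i ∈ N∖(S∪{r}). -/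
open Finset

/-- Lagrangian optimality criterion for the follower: if `y` is feasible, uses up the resources
unless the multiplier `lam` vanishes, and maximises each Lagrangian term separately, then `y`
attains the worst case. -/
theorem worstProd_eq_totProd_of_multiplier {n : ℕ} {p a : Fin n → ℝ} (ha : ∀ i, 0 < a i)
    {Rf : ℝ} {x y : Fin n → ℝ} {lam : ℝ} (hlam : 0 ≤ lam) (hy : y ∈ followerSet n a Rf)
    (hslack : lam * ∑ i, y i = lam * Rf)
    (hopt : ∀ i z, 0 ≤ z → z ≤ a i → 0 ≤ (p i * x i / a i - lam) * (y i - z)) :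
    worstProd n p a Rf x = totProd n p a x y := by
  refine IsLeast.csInf_eq ⟨⟨y, hy, rfl⟩, ?_⟩
  rintro _ ⟨z, ⟨hz, hzsum⟩, rfl⟩
  have hdiff : totProd n p a x z - totProd n p a x y =
      ∑ i, (p i * x i / a i - lam) * (y i - z i) + lam * (∑ i, y i - ∑ i, z i) := by
    simp only [totProd]
    rw [← Finset.sum_sub_distrib, ← Finset.sum_sub_distrib, Finset.mul_sum,
      ← Finset.sum_add_distrib]
    refine Finset.sum_congr rfl fun i _ => ?_
    have := (ha i).ne'
    field_simp
    ring
  have hterms : 0 ≤ ∑ i, (p i * x i / a i - lam) * (y i - z i) :=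
    Finset.sum_nonneg fun i _ => hopt i (z i) (hz i).1 (hz i).2
  have hbudget := mul_le_mul_of_nonneg_left hzsum hlam
  linarith [mul_sub lam (∑ i, y i) (∑ i, z i)]

/-- A function vanishing off `insert r S` sums to its value at `r` plus its sum over `S`. -/
theorem sum_univ_eq_add_sum_of_support {n : ℕ} {S : Finset (Fin n)} {r : Fin n} (hr : r ∉ S)
    {f : Fin n → ℝ} (hf : ∀ i, i ∉ insert r S → f i = 0) :
    ∑ i, f i = f r + ∑ i ∈ S, f i := by
  rw [← Finset.sum_insert hr]
  exact (Finset.sum_subset (Finset.subset_univ _) fun i _ hi => hf i hi).symm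

theorem semiBalancedWorstProdFormula {n : ℕ} (hn : 0 < n) (p a : Fin n → ℝ)
    (hp : ∀ i, 0 < p i) (hpmono : ∀ i j : Fin n, i ≤ j → p j ≤ p i)
    (ha : ∀ i, 0 < a i) (Rl Rf : ℝ) (hRl : 0 < Rl) (hRf : 0 < Rf)
    (hRfa : Rf < ∑ i, a i)
    (x : Fin n → ℝ) (hx : x ∈ leaderSet n Rl)
    (S : Finset (Fin n)) (r : Fin n)
    (hsemi : SemiBalancedStrategy n p a Rl x S r) :
    (Rf ≤ ∑ i ∈ S, a i →
      worstProd n p a Rf x = pbar n p a Rf S * (Rl - x r) + p r * x r) ∧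
    (∑ i ∈ S, a i < Rf → Rf < ∑ i ∈ insert r S, a i →
      worstProd n p a Rf x = p r * x r / a r * (∑ i ∈ insert r S, a i - Rf)) ∧
    (∑ i ∈ insert r S, a i ≤ Rf → worstProd n p a Rf x = 0) ∧
    (∀ i ∈ S, x i = a i * (Rl - x r) / (p i * ∑ j ∈ S, a j / p j)) ∧
    (∀ i, i ∉ insert r S → x i = 0) := by
  obtain ⟨hr, hsum, hpos, hbal, hlt, hzero⟩ := hsemi
  have hw : ∀ i, 0 ≤ p i * x i / a i := fun i =>
    div_nonneg (mul_nonneg (hp i).le (hx.1 i)) (ha i).le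
  have hwoff : ∀ i, i ∉ insert r S → p i * x i / a i = 0 := fun i hi => by simp [hzero i hi]
  have hwr : 0 < p r * x r / a r :=
    div_pos (mul_pos (hp r) (hpos r (by simp))) (ha r)
  have hxS : ∑ i ∈ S, x i = Rl - x r := by
    rw [← hsum, sum_univ_eq_add_sum_of_support hr hzero]
    ring
  have htot : ∀ y, totProd n p a x y =
      p r * x r * (1 - y r / a r) + ∑ i ∈ S, p i * x i * (1 - y i / a i) := fun y =>
    sum_univ_eq_add_sum_of_support hr fun i hi => by simp [hzero i hi]
  have hden : ∀ k ∈ S, 0 < ∑ j ∈ S, a j / p j := fun k hk =>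
    Finset.sum_pos (fun j _ => div_pos (ha j) (hp j)) ⟨k, hk⟩
  have hlevel : ∀ k ∈ S, p k * x k / a k * ∑ j ∈ S, a j / p j = Rl - x r := by
    intro k hk
    rw [← hxS, Finset.mul_sum]
    refine Finset.sum_congr rfl fun j hj => ?_
    rw [hbal k hk j hj]
    have := (ha j).ne'
    have := (hp j).ne'
    field_simp
  refine ⟨?_, ?_, ?_, ?_, hzero⟩
  · intro hle
    obtain ⟨k, hk⟩ : S.Nonempty := by
      by_contra hne
      rw [Finset.not_nonempty_iff_eq_empty.mp hne, Finset.sum_empty] at hle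
      linarith
    have hA : 0 < ∑ i ∈ S, a i := hRf.trans_le hle
    set A := ∑ i ∈ S, a i with hAdef
    set c := p k * x k / a k with hc
    let y : Fin n → ℝ := fun i => if i ∈ S then a i * (Rf / A) else 0
    have hysum : ∑ i, y i = Rf := by
      simp only [y, Finset.sum_ite_mem, Finset.univ_inter]
      rw [← Finset.sum_mul, ← hAdef]
      field_simp
    have hymem : y ∈ followerSet n a Rf := by
      refine ⟨fun i => ?_, hysum.le⟩
      have hai := ha i
      by_cases hi : i ∈ S
      · simp only [y, if_pos hi]
        exact ⟨by positivity, mul_le_of_le_one_right hai.le ((div_le_one hA).mpr hle)⟩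
      · simp only [y, if_neg hi]
        exact ⟨le_rfl, hai.le⟩
    rw [worstProd_eq_totProd_of_multiplier ha (hw k) hymem (by rw [hysum]), htot]
    · have hSsum : ∑ i ∈ S, p i * x i * (1 - y i / a i) = c * (A - Rf) := by
        have hterm : ∀ i ∈ S, p i * x i * (1 - y i / a i) = a i * (c * (1 - Rf / A)) := by
          intro i hi
          rw [hc, hbal k hk i hi]
          simp only [y, if_pos hi]
          have := (ha i).ne'
          field_simp
        rw [Finset.sum_congr rfl hterm, ← Finset.sum_mul, ← hAdef]
        field_simp
      have hden' := hden k hk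
      have hne : S ≠ ∅ := Finset.ne_empty_of_mem hk
      rw [hSsum, pbar, if_neg hne, max_eq_left (div_nonneg (sub_nonneg.mpr hle) hden'.le),
        ← hlevel k hk]
      simp only [y, if_neg hr]
      field_simp
      ring
    · intro i z hz0 hza
      by_cases hi : i ∈ S
      · rw [hbal k hk i hi]
        simp
      · simp only [y, if_neg hi]
        refine mul_nonneg_of_nonpos_of_nonpos ?_ (by linarith)
        by_cases hir : i = r
        · subst hir
          linarith [hlt k hk]
        · rw [hwoff i (by simp [hi, hir])]
          linarith [hw k]
  · intro hgt hlt'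
    rw [Finset.sum_insert hr] at hlt' ⊢
    set A := ∑ i ∈ S, a i with hAdef
    let y : Fin n → ℝ := fun i => if i = r then Rf - A else if i ∈ S then a i else 0
    have hyr : y r = Rf - A := by simp [y]
    have hyS : ∀ i ∈ S, y i = a i := fun i hi => by
      simp [y, hi, ne_of_mem_of_not_mem hi hr]
    have hyoff : ∀ i, i ∉ insert r S → y i = 0 := fun i hi => by
      simp only [Finset.mem_insert, not_or] at hi
      simp [y, hi.1, hi.2]
    have hysum : ∑ i, y i = Rf := by
      rw [sum_univ_eq_add_sum_of_support hr hyoff, Finset.sum_congr rfl hyS, hyr]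
      ring
    have hymem : y ∈ followerSet n a Rf := by
      refine ⟨fun i => ?_, hysum.le⟩
      by_cases hir : i = r
      · subst hir
        rw [hyr]
        constructor <;> linarith
      by_cases hi : i ∈ S
      · rw [hyS i hi]
        exact ⟨(ha i).le, le_rfl⟩
      · rw [hyoff i (by simp [hi, hir])]
        exact ⟨le_rfl, (ha i).le⟩
    rw [worstProd_eq_totProd_of_multiplier ha hwr.le hymem (by rw [hysum]), htot]
    · rw [Finset.sum_eq_zero fun i hi => by rw [hyS i hi, div_self (ha i).ne']; ring, hyr]
      have := (ha r).ne'
      field_simp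
      ring
    · intro i z hz0 hza
      by_cases hir : i = r
      · simp [hir]
      by_cases hi : i ∈ S
      · rw [hyS i hi]
        exact mul_nonneg (by linarith [hlt i hi]) (by linarith)
      · have hi' : i ∉ insert r S := by simp [hi, hir]
        rw [hyoff i hi', hwoff i hi']
        exact mul_nonneg_of_nonpos_of_nonpos (by linarith) (by linarith)
  · intro hle
    let y : Fin n → ℝ := fun i => if i ∈ insert r S then a i else 0
    have hyon : ∀ i ∈ insert r S, y i = a i := fun i hi => if_pos hi
    have hymem : y ∈ followerSet n a Rf := by
      refine ⟨fun i => ?_, ?_⟩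
      · by_cases hi : i ∈ insert r S
        · rw [hyon i hi]
          exact ⟨(ha i).le, le_rfl⟩
        · simp only [y, if_neg hi]
          exact ⟨le_rfl, (ha i).le⟩
      · simpa only [y, Finset.sum_ite_mem, Finset.univ_inter] using hle
    rw [worstProd_eq_totProd_of_multiplier ha le_rfl hymem (by simp)]
    · refine Finset.sum_eq_zero fun i _ => ?_
      by_cases hi : i ∈ insert r S
      · rw [hyon i hi, div_self (ha i).ne']
        ring
      · simp [hzero i hi]
    · intro i z hz0 hza
      by_cases hi : i ∈ insert r S
      · rw [hyon i hi, sub_zero]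
        exact mul_nonneg (hw i) (by linarith)
      · simp [hwoff i hi]
  · intro i hi
    have := hden i hi
    have := ha i
    have := hp i
    rw [← hlevel i hi]
    field_simp
end

section
/- Let S and T be nonempty disjoint subsets of N. If p_i ≥ p̄(S) for all i ∈ T, then p̄(S ∪ T) ≥ p̄(S). -/
open Finset

theorem pbarUnionGe_ofRatesGePbarS {n : ℕ} (p a : Fin n → ℝ)
    (hp : ∀ i, 0 < p i) (ha : ∀ i, 0 < a i)
    (Rf : ℝ) (hRf : 0 < Rf) (hRfa : Rf < ∑ i, a i)
    (S T : Finset (Fin n)) (hS : S.Nonempty) (hT : T.Nonempty)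
    (hST : Disjoint S T)
    (h : ∀ i ∈ T, pbar n p a Rf S ≤ p i) :
    pbar n p a Rf S ≤ pbar n p a Rf (S ∪ T) := by
  have hU : (S ∪ T).Nonempty := hS.mono subset_union_left
  simp only [pbar, if_neg hS.ne_empty, if_neg hU.ne_empty] at h ⊢
  refine max_le_max_right 0 ?_
  have hq : ∀ i, 0 < a i / p i := fun i => div_pos (ha i) (hp i)
  have hDS : 0 < ∑ i ∈ S, a i / p i := sum_pos (fun i _ => hq i) hS
  have hDU : 0 < ∑ i ∈ S ∪ T, a i / p i := sum_pos (fun i _ => hq i) hU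
  rw [le_div_iff₀ hDU, sum_union hST, sum_union hST, mul_add, div_mul_cancel₀ _ hDS.ne', mul_sum]
  have hsum : ∑ i ∈ T, (∑ i ∈ S, a i - Rf) / (∑ i ∈ S, a i / p i) * (a i / p i) ≤
      ∑ i ∈ T, a i := by
    refine sum_le_sum fun i hi => ?_
    calc _ ≤ p i * (a i / p i) :=
          mul_le_mul_of_nonneg_right ((le_max_left _ _).trans (h i hi)) (hq i).le
      _ = a i := mul_div_cancel₀ _ (hp i).ne'
  linarith
end

section
/- Let S and T be nonempty disjoint subsets of N. If p_i ≤ p̄(S) for all i ∈ T, then p̄(S ∪ T) ≤ p̄(S). -/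
open Finset

theorem pbarUnionLe_ofRatesLePbarS {n : ℕ} (p a : Fin n → ℝ)
    (hp : ∀ i, 0 < p i) (ha : ∀ i, 0 < a i)
    (Rf : ℝ) (hRf : 0 < Rf) (hRfa : Rf < ∑ i, a i)
    (S T : Finset (Fin n)) (hS : S.Nonempty) (hT : T.Nonempty)
    (hST : Disjoint S T)
    (h : ∀ i ∈ T, p i ≤ pbar n p a Rf S) :
    pbar n p a Rf (S ∪ T) ≤ pbar n p a Rf S := by
  set P := pbar n p a Rf S with hP
  have hP0 : 0 ≤ P := by
    simp [hP, pbar, hS.ne_empty]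
  have hpos (U : Finset (Fin n)) (hU : U.Nonempty) : 0 < ∑ i ∈ U, a i / p i :=
    sum_pos (fun i _ => div_pos (ha i) (hp i)) hU
  have hSP : ∑ i ∈ S, a i - Rf ≤ P * ∑ i ∈ S, a i / p i := by
    rw [← div_le_iff₀ (hpos S hS), hP, pbar, if_neg hS.ne_empty]
    exact le_max_left _ _
  have hTP : ∑ i ∈ T, a i ≤ P * ∑ i ∈ T, a i / p i := by
    rw [mul_sum]
    refine sum_le_sum fun i hi => ?_
    rw [mul_div_assoc', le_div_iff₀ (hp i), mul_comm P]
    exact mul_le_mul_of_nonneg_left (h i hi) (ha i).le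
  have hU : (S ∪ T).Nonempty := hS.mono subset_union_left
  rw [pbar, if_neg hU.ne_empty]
  refine max_le ?_ hP0
  rw [div_le_iff₀ (hpos _ hU), sum_union hST, sum_union hST, mul_add]
  linarith
end

section
/- Let S and T be nonempty disjoint subsets of N. If p_i ≥ p̄(S ∪ T) for all i ∈ T, then p̄(S ∪ T) ≥ p̄(S). -/
open Finset

theorem pbarUnionGe_ofRatesGePbarUnion {n : ℕ} (p a : Fin n → ℝ)
    (hp : ∀ i, 0 < p i) (ha : ∀ i, 0 < a i)
    (Rf : ℝ) (hRf : 0 < Rf) (hRfa : Rf < ∑ i, a i)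
    (S T : Finset (Fin n)) (hS : S.Nonempty) (hT : T.Nonempty)
    (hST : Disjoint S T)
    (h : ∀ i ∈ T, pbar n p a Rf (S ∪ T) ≤ p i) :
    pbar n p a Rf S ≤ pbar n p a Rf (S ∪ T) := by
  have time_pos : ∀ U : Finset (Fin n), U.Nonempty → 0 < ∑ i ∈ U, a i / p i :=
    fun U hU => sum_pos (fun i _ => div_pos (ha i) (hp i)) hU
  have hU : (S ∪ T).Nonempty := hS.mono subset_union_left
  have pbar_eq : ∀ U : Finset (Fin n), U.Nonempty → pbar n p a Rf U =
      max ((∑ i ∈ U, a i - Rf) / (∑ i ∈ U, a i / p i)) 0 :=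
    fun U hU => if_neg hU.ne_empty
  have hle : (∑ i ∈ S ∪ T, a i - Rf) / (∑ i ∈ S ∪ T, a i / p i) ≤ pbar n p a Rf (S ∪ T) := by
    rw [pbar_eq _ hU]
    exact le_max_left _ _
  have hnonneg : 0 ≤ pbar n p a Rf (S ∪ T) := by
    rw [pbar_eq _ hU]
    exact le_max_right _ _
  rw [pbar_eq S hS]
  generalize pbar n p a Rf (S ∪ T) = v at *
  have hvT : v * ∑ i ∈ T, a i / p i ≤ ∑ i ∈ T, a i := by
    rw [mul_sum]
    refine sum_le_sum fun i hi => ?_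
    rw [← mul_div_assoc, div_le_iff₀ (hp i), mul_comm]
    exact mul_le_mul_of_nonneg_left (h i hi) (ha i).le
  rw [div_le_iff₀ (time_pos _ hU), sum_union hST, sum_union hST] at hle
  refine max_le ?_ hnonneg
  rw [div_le_iff₀ (time_pos S hS)]
  linarith
end

section
/- Let S and T be nonempty disjoint subsets of N. If p_i ≤ p̄(S ∪ T) for all i ∈ T, then p̄(S ∪ T) ≤ p̄(S). -/
open Finset

theorem pbarUnionLe_ofRatesLePbarUnion {n : ℕ} (p a : Fin n → ℝ)
    (hp : ∀ i, 0 < p i) (ha : ∀ i, 0 < a i)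
    (Rf : ℝ) (hRf : 0 < Rf) (hRfa : Rf < ∑ i, a i)
    (S T : Finset (Fin n)) (hS : S.Nonempty) (hT : T.Nonempty)
    (hST : Disjoint S T)
    (h : ∀ i ∈ T, p i ≤ pbar n p a Rf (S ∪ T)) :
    pbar n p a Rf (S ∪ T) ≤ pbar n p a Rf S := by
  have hSU : S ∪ T ≠ ∅ := (hS.mono subset_union_left).ne_empty
  obtain ⟨t, ht⟩ := hT
  have hU : 0 < pbar n p a Rf (S ∪ T) := (hp t).trans_le (h t ht)
  have hB : ∀ V : Finset (Fin n), V.Nonempty → 0 < ∑ i ∈ V, a i / p i :=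
    fun V hV => sum_pos (fun i _ => div_pos (ha i) (hp i)) hV
  have hBS := hB S hS
  have hBU := hB (S ∪ T) (hS.mono subset_union_left)
  have hA : ∑ i ∈ T, a i ≤ pbar n p a Rf (S ∪ T) * ∑ i ∈ T, a i / p i := by
    rw [mul_sum]
    refine sum_le_sum fun i hi => ?_
    rw [← mul_div_assoc, le_div_iff₀ (hp i), mul_comm]
    exact mul_le_mul_of_nonneg_right (h i hi) (ha i).le
  have hE : pbar n p a Rf (S ∪ T) * ∑ i ∈ S ∪ T, a i / p i = ∑ i ∈ S ∪ T, a i - Rf := by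
    rw [← eq_div_iff hBU.ne']
    have hmax := hU
    simp only [pbar, if_neg hSU] at hmax ⊢
    rcases lt_max_iff.mp hmax with hpos | hpos
    · exact max_eq_left hpos.le
    · exact absurd hpos (lt_irrefl 0)
  rw [sum_union hST, sum_union hST] at hE
  have hS' : pbar n p a Rf S =
      max ((∑ i ∈ S, a i - Rf) / (∑ i ∈ S, a i / p i)) 0 := if_neg hS.ne_empty
  rw [hS']
  refine le_max_of_le_left ?_
  rw [le_div_iff₀ hBS]
  linarith
end

section
/- There exists a strategy x ∈ 𝒳 that is optimal for the leader (i.e., P(x) ≥ P(x') for all x' ∈ 𝒳) and is seried-balanced, that is, x is balanced with support S = {1,...,s} for some s ∈ N. -/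
open Finset

/-- If `A_s - ρ C_s ≤ Rf` for every initial segment, then the follower can afford to lower every
net production rate to at most `ρ`. -/
theorem sum_max_le_of_prefix {n : ℕ} {p a : Fin n → ℝ}
    (hp : ∀ i, 0 < p i) (hpmono : ∀ i j : Fin n, i ≤ j → p j ≤ p i)
    {Rf ρ : ℝ} (hRf : 0 ≤ Rf)
    (h : ∀ s : Fin n, ∑ i with i ≤ s, a i - Rf ≤ ρ * ∑ i with i ≤ s, a i / p i) :
    ∑ i, a i * max (1 - ρ / p i) 0 ≤ Rf := by
  have hsplit : ∑ i, a i * max (1 - ρ / p i) 0 = ∑ i with ρ < p i, a i * (1 - ρ / p i) := by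
    rw [Finset.sum_filter]
    refine Finset.sum_congr rfl fun i _ => ?_
    split_ifs with hi
    · rw [max_eq_left (sub_nonneg.2 ((div_le_one (hp i)).2 hi.le))]
    · rw [max_eq_right (sub_nonpos.2 ((one_le_div (hp i)).2 (not_lt.1 hi))), mul_zero]
  rw [hsplit]
  rcases (Finset.univ.filter fun i => ρ < p i).eq_empty_or_nonempty with hT | hT
  · rwa [hT, Finset.sum_empty]
  · obtain ⟨s, hs, hmax⟩ := Finset.exists_max_image _ id hT
    have hTs : (Finset.univ.filter fun i => ρ < p i) = Finset.univ.filter (· ≤ s) := by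
      ext i
      simp only [Finset.mem_filter, Finset.mem_univ, true_and, id] at hs hmax ⊢
      exact ⟨hmax i, fun hi => hs.trans_le (hpmono i s hi)⟩
    have hsum : ∑ i with i ≤ s, a i * (1 - ρ / p i) =
        ∑ i with i ≤ s, a i - ρ * ∑ i with i ≤ s, a i / p i := by
      rw [Finset.mul_sum, ← Finset.sum_sub_distrib]
      exact Finset.sum_congr rfl fun i _ => by ring
    rw [hTs, hsum]
    linarith [h s]

/-- If the follower can lower every net production rate to at most `ρ`, the worst case total
production is at most `ρ * Rl`. -/
theorem worstProd_le {n : ℕ} {p a : Fin n → ℝ} (hp : ∀ i, 0 < p i) (ha : ∀ i, 0 < a i)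
    {Rl Rf ρ : ℝ} (hρ : 0 ≤ ρ) (h : ∑ i, a i * max (1 - ρ / p i) 0 ≤ Rf)
    {x : Fin n → ℝ} (hx : x ∈ leaderSet n Rl) : worstProd n p a Rf x ≤ ρ * Rl := by
  have hbdd : BddBelow (totProd n p a x '' followerSet n a Rf) := by
    refine ⟨0, ?_⟩
    rintro _ ⟨y, hy, rfl⟩
    exact Finset.sum_nonneg fun i _ => mul_nonneg (mul_nonneg (hp i).le (hx.1 i))
      (sub_nonneg.2 ((div_le_one (ha i)).2 (hy.1 i).2))
  have hy : (fun i => a i * max (1 - ρ / p i) 0) ∈ followerSet n a Rf :=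
    ⟨fun i => ⟨mul_nonneg (ha i).le (le_max_right _ _), mul_le_of_le_one_right (ha i).le
      (max_le (sub_le_self _ (div_nonneg hρ (hp i).le)) zero_le_one)⟩, h⟩
  refine (csInf_le hbdd ⟨_, hy, rfl⟩).trans ?_
  calc totProd n p a x _ ≤ ∑ i, ρ * x i := by
        refine Finset.sum_le_sum fun i _ => ?_
        have hrate : p i * (1 - max (1 - ρ / p i) 0) ≤ ρ := by
          have hm := mul_le_mul_of_nonneg_left (le_max_left (1 - ρ / p i) 0) (hp i).le
          have hc : p i * (ρ / p i) = ρ := mul_div_cancel₀ _ (hp i).ne'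
          linarith
        rw [mul_div_cancel_left₀ _ (ha i).ne', mul_right_comm]
        exact mul_le_mul_of_nonneg_right hrate (hx.1 i)
    _ = ρ * ∑ i, x i := (Finset.mul_sum _ _ _).symm
    _ ≤ ρ * Rl := mul_le_mul_of_nonneg_left hx.2 hρ

/-- The strategy with support `S` whose common ratio `p i * x i / a i` equals `q`. -/
noncomputable def constRatioStrategy {n : ℕ} (p a : Fin n → ℝ) (q : ℝ) (S : Finset (Fin n)) :
    Fin n → ℝ :=
  fun i => if i ∈ S then q * (a i / p i) else 0

theorem le_worstProd_constRatioStrategy {n : ℕ} {p a : Fin n → ℝ} (hp : ∀ i, 0 < p i)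
    (ha : ∀ i, 0 < a i) {q Rf : ℝ} (hq : 0 ≤ q) (hRf : 0 ≤ Rf) (S : Finset (Fin n)) :
    q * (∑ i ∈ S, a i - Rf) ≤ worstProd n p a Rf (constRatioStrategy p a q S) := by
  refine le_csInf (Set.Nonempty.image _ ⟨0, fun i => ⟨le_rfl, (ha i).le⟩, by simpa using hRf⟩) ?_
  rintro _ ⟨y, hy, rfl⟩
  have htot : totProd n p a (constRatioStrategy p a q S) y = q * (∑ i ∈ S, a i - ∑ i ∈ S, y i) := by
    rw [← Finset.sum_sub_distrib, Finset.mul_sum, totProd,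
      ← Finset.sum_subset (Finset.subset_univ S) fun i _ hi => by
        rw [constRatioStrategy, if_neg hi, mul_zero, zero_mul]]
    refine Finset.sum_congr rfl fun i hi => ?_
    have := (hp i).ne'
    have := (ha i).ne'
    rw [constRatioStrategy, if_pos hi]
    field_simp
  rw [htot]
  have hle : ∑ i ∈ S, y i ≤ ∑ i, y i :=
    Finset.sum_le_sum_of_subset_of_nonneg (Finset.subset_univ S) fun i _ _ => (hy.1 i).1
  exact mul_le_mul_of_nonneg_left (by linarith [hy.2]) hq

theorem balancedStrategy_constRatioStrategy {n : ℕ} {p a : Fin n → ℝ} (hp : ∀ i, 0 < p i)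
    (ha : ∀ i, 0 < a i) {q Rl : ℝ} (hq : 0 < q) {S : Finset (Fin n)}
    (h : q * ∑ i ∈ S, a i / p i = Rl) :
    BalancedStrategy n p a Rl (constRatioStrategy p a q S) S := by
  have hratio : ∀ i ∈ S, p i * constRatioStrategy p a q S i / a i = q := fun i hi => by
    have := (hp i).ne'
    have := (ha i).ne'
    rw [constRatioStrategy, if_pos hi]
    field_simp
  refine ⟨?_, fun i hi => ?_, fun i hi j hj => (hratio i hi).trans (hratio j hj).symm,
    fun i hi => if_neg hi⟩
  · simp only [constRatioStrategy, Finset.sum_ite_mem, Finset.univ_inter]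
    rw [← Finset.mul_sum, h]
  · rw [constRatioStrategy, if_pos hi]
    exact mul_pos hq (div_pos (ha i) (hp i))

theorem existsOptimalSeriedBalanced {n : ℕ} (hn : 0 < n) (p a : Fin n → ℝ)
    (hp : ∀ i, 0 < p i) (hpmono : ∀ i j : Fin n, i ≤ j → p j ≤ p i)
    (ha : ∀ i, 0 < a i) (Rl Rf : ℝ) (hRl : 0 < Rl) (hRf : 0 < Rf)
    (hRfa : Rf < ∑ i, a i) :
    ∃ x ∈ leaderSet n Rl,
      (∀ x' ∈ leaderSet n Rl, worstProd n p a Rf x' ≤ worstProd n p a Rf x) ∧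
      ∃ s : Fin n,
        BalancedStrategy n p a Rl x (Finset.filter (fun i => i ≤ s) Finset.univ) := by
  set A : Fin n → ℝ := fun s => ∑ i with i ≤ s, a i with hA
  set C : Fin n → ℝ := fun s => ∑ i with i ≤ s, a i / p i
  have hCpos : ∀ s, 0 < C s := fun s =>
    Finset.sum_pos (fun i _ => div_pos (ha i) (hp i)) ⟨s, by simp⟩
  let last : Fin n := ⟨n - 1, by omega⟩
  obtain ⟨s, -, hs⟩ := Finset.exists_max_image Finset.univ (fun s => (A s - Rf) / C s)
    ⟨last, Finset.mem_univ _⟩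
  set ρ := (A s - Rf) / C s with hρ_def
  have hlast : A last = ∑ i, a i := by
    simp only [hA]
    rw [Finset.filter_true_of_mem]
    intro i _
    exact Fin.le_def.2 (Nat.le_sub_one_of_lt i.isLt)
  have hρ : 0 ≤ ρ :=
    (div_pos (by rw [hlast]; linarith) (hCpos last)).le.trans (hs last (Finset.mem_univ _))
  have hprefix : ∀ t, A t - Rf ≤ ρ * C t := fun t =>
    (div_le_iff₀ (hCpos t)).1 (hs t (Finset.mem_univ _))
  have hq : 0 < Rl / C s := div_pos hRl (hCpos s)
  have hbal := balancedStrategy_constRatioStrategy hp ha hq (div_mul_cancel₀ Rl (hCpos s).ne')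
  refine ⟨_, ⟨fun i => ?_, hbal.1.le⟩, fun x' hx' => ?_, s, hbal⟩
  · by_cases hi : i ∈ Finset.univ.filter (· ≤ s)
    · exact (hbal.2.1 i hi).le
    · exact (hbal.2.2.2 i hi).ge
  · calc worstProd n p a Rf x' ≤ ρ * Rl :=
          worstProd_le hp ha hρ (sum_max_le_of_prefix hp hpmono hRf.le hprefix) hx'
      _ = Rl / C s * (A s - Rf) := by rw [hρ_def]; ring
      _ ≤ _ := le_worstProd_constRatioStrategy hp ha hq.le hRf.le _
end

section
/- Let S ⊆ N be nonempty, let r ∈ N∖S, and let x_r > 0 and R_l > 0 be real numbers. Assume R_f ≤ Σ_{i∈S} a_i, p_r > p̄(S), and (p_r x_r)/a_r < (R_l − x_r)/(Σ_{j∈S} a_j/p_j). Then p̄(S ∪ {r})·R_l > p̄(S)·(R_l − x_r) + p_r x_r. -/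
open Finset

/-- If `q * B = A`, `q < P` and `x` is less than the share `b / (B + b)` of `R`, then mixing the
rates `q` and `P` in the proportions `R - x` and `x` yields less than the weighted mean rate. -/
lemma mixed_rate_lt_weighted_mean {A B P b q x R : ℝ} (hB : 0 < B) (hb : 0 < b)
    (hq : q * B = A) (hqP : q < P) (hx : x * (B + b) < R * b) :
    q * (R - x) + P * x < (A + P * b) / (B + b) * R := by
  rw [div_mul_eq_mul_div, lt_div_iff₀ (by positivity), ← hq]
  linear_combination (P - q) * hx

theorem semiBalancedDominatedByBalancedUnion {n : ℕ} (p a : Fin n → ℝ)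
    (hp : ∀ i, 0 < p i) (ha : ∀ i, 0 < a i)
    (Rf : ℝ) (hRf : 0 < Rf) (hRfa : Rf < ∑ i, a i)
    (S : Finset (Fin n)) (hS : S.Nonempty) (r : Fin n) (hr : r ∉ S)
    (xr Rl : ℝ) (hxr : 0 < xr) (hRl : 0 < Rl)
    (h1 : Rf ≤ ∑ i ∈ S, a i)
    (h2 : pbar n p a Rf S < p r)
    (h3 : p r * xr / a r < (Rl - xr) / (∑ j ∈ S, a j / p j)) :
    pbar n p a Rf S * (Rl - xr) + p r * xr < pbar n p a Rf (insert r S) * Rl := by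
  have hB : 0 < ∑ j ∈ S, a j / p j := sum_pos (fun i _ => div_pos (ha i) (hp i)) hS
  have hb : 0 < a r / p r := div_pos (ha r) (hp r)
  have hA : 0 ≤ ∑ i ∈ S, a i - Rf := sub_nonneg.mpr h1
  have hPb : p r * (a r / p r) = a r := mul_div_cancel₀ _ (hp r).ne'
  have hx : xr * (∑ j ∈ S, a j / p j + a r / p r) < Rl * (a r / p r) := by
    rw [div_lt_div_iff₀ (ha r) hB, ← hPb] at h3
    have h : xr * ∑ j ∈ S, a j / p j < (Rl - xr) * (a r / p r) :=
      lt_of_mul_lt_mul_left (by linarith) (hp r).le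
    linarith
  have hqS : pbar n p a Rf S = (∑ i ∈ S, a i - Rf) / ∑ i ∈ S, a i / p i := by
    rw [pbar, if_neg hS.ne_empty, max_eq_left (div_nonneg hA hB.le)]
  have hqT : pbar n p a Rf (insert r S) =
      (∑ i ∈ S, a i - Rf + p r * (a r / p r)) / (∑ i ∈ S, a i / p i + a r / p r) := by
    rw [pbar, if_neg (insert_ne_empty r S), sum_insert hr, sum_insert hr, hPb,
      show a r + ∑ i ∈ S, a i - Rf = ∑ i ∈ S, a i - Rf + a r by ring, add_comm (a r / p r)]
    exact max_eq_left (div_nonneg (add_nonneg hA (ha r).le) (add_pos hB hb).le)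
  rw [hqT]
  exact mixed_rate_lt_weighted_mean hB hb (by rw [hqS, div_mul_cancel₀ _ hB.ne']) h2 hx
end

section
/- Let S and T be nonempty disjoint subsets of N with Σ_{j∈S} a_j ≤ R_f < Σ_{j∈S∪T} a_j. Then it is impossible that p_i ≤ p̄(S ∪ T) for all i ∈ T; equivalently, there exists i ∈ T with p_i > p̄(S ∪ T). -/
open Finset

theorem existsRateAbovePbarUnion {n : ℕ} (p a : Fin n → ℝ)
    (hp : ∀ i, 0 < p i) (ha : ∀ i, 0 < a i)
    (Rf : ℝ) (hRf : 0 < Rf) (hRfa : Rf < ∑ i, a i)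
    (S T : Finset (Fin n)) (hS : S.Nonempty) (hT : T.Nonempty)
    (hST : Disjoint S T)
    (h1 : ∑ j ∈ S, a j ≤ Rf) (h2 : Rf < ∑ j ∈ S ∪ T, a j) :
    ∃ i ∈ T, pbar n p a Rf (S ∪ T) < p i := by
  by_contra! hcon
  have hne : S ∪ T ≠ ∅ := (hS.mono subset_union_left).ne_empty
  have hBS : 0 < ∑ i ∈ S, a i / p i := sum_pos (fun i _ => div_pos (ha i) (hp i)) hS
  have hBT : 0 < ∑ i ∈ T, a i / p i := sum_pos (fun i _ => div_pos (ha i) (hp i)) hT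
  have hB : 0 < ∑ i ∈ S ∪ T, a i / p i := by
    rw [sum_union hST]
    positivity
  have hP : pbar n p a Rf (S ∪ T)
      = (∑ i ∈ S ∪ T, a i - Rf) / (∑ i ∈ S ∪ T, a i / p i) := by
    rw [pbar, if_neg hne]
    exact max_eq_left (div_nonneg (sub_nonneg.2 h2.le) hB.le)
  have hPpos : 0 < pbar n p a Rf (S ∪ T) := by
    rw [hP]
    exact div_pos (sub_pos.2 h2) hB
  have hbal := (eq_div_iff hB.ne').1 hP
  rw [sum_union hST, sum_union hST, mul_add] at hbal
  have hTle : ∑ i ∈ T, a i ≤ pbar n p a Rf (S ∪ T) * ∑ i ∈ T, a i / p i := by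
    rw [mul_sum]
    refine sum_le_sum fun i hi => ?_
    calc a i = p i * (a i / p i) := (mul_div_cancel₀ _ (hp i).ne').symm
      _ ≤ _ := mul_le_mul_of_nonneg_right (hcon i hi) (div_pos (ha i) (hp i)).le
  linarith [mul_pos hPpos hBS]
end
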